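/- arXiv:2010.15375 — 2 statements merged into one kernel-verified Lean document; each statement's English description precedes it below -/
import Mathlib

section
/- Let g : ℕ → ℝ satisfy |g(t)| ≤ M for all t, let ε ∈ (0,1), and set σ := ε Σ_{t=0}^{∞} (1−ε)^t g(t). Then for every δ > 0 there exists a positive integer T with T ≥ δ / ((4M + 4|σ| + δ)(−ln(1−ε))) such that (1/T) Σ_{t=0}^{T−1} g(t) < σ + δ + 2M/T. -/
open MeasureTheory Filter Set Topology
open scoped ENNReal NNReal

noncomputable section

namespace StochLP

/-- The model of the controlled stochastic discrete time system (controlled stochastic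
recursion) `y(t+1) = f(y(t), u(t), s(t))` from the paper: `Y ⊂ ℝⁿ` is a compact forward
invariant state constraint set, `Uc` is a compact metric control space, `S` is a Polish
noise space, `U` is an upper semicontinuous compact valued control constraint
multifunction (upper semicontinuity of a compact valued map into a compact space being
recorded as closedness of its graph), `f` is bounded, continuous in `(y,u)` and Borel
measurable in `s`, and `ν` is the common law of the i.i.d. noise elements `s(t)`. -/
structure Model (n : ℕ) (Uc S : Type) [MetricSpace Uc] [CompactSpace Uc]
    [MeasurableSpace Uc] [BorelSpace Uc] [TopologicalSpace S] [PolishSpace S]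
    [MeasurableSpace S] [BorelSpace S] where
  Y : Set (Fin n → ℝ)
  U : (Fin n → ℝ) → Set Uc
  f : (Fin n → ℝ) → Uc → S → (Fin n → ℝ)
  ν : Measure S
  ν_prob : IsProbabilityMeasure ν
  Y_compact : IsCompact Y
  Y_nonempty : Y.Nonempty
  U_nonempty : ∀ y ∈ Y, (U y).Nonempty
  U_compact : ∀ y ∈ Y, IsCompact (U y)
  graph_closed : IsClosed {p : (Fin n → ℝ) × Uc | p.1 ∈ Y ∧ p.2 ∈ U p.1}
  f_bounded : ∃ C : ℝ, ∀ y ∈ Y, ∀ (u : Uc) (s : S), ‖f y u s‖ ≤ C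
  f_cont : ∀ s : S, ContinuousOn (fun p : (Fin n → ℝ) × Uc => f p.1 p.2 s) (Y ×ˢ univ)
  f_meas : ∀ y ∈ Y, ∀ u : Uc, Measurable fun s => f y u s
  f_inv : ∀ y ∈ Y, ∀ u ∈ U y, ∀ s : S, f y u s ∈ Y

variable {n : ℕ} {Uc S : Type} [MetricSpace Uc] [CompactSpace Uc] [MeasurableSpace Uc]
  [BorelSpace Uc] [TopologicalSpace S] [PolishSpace S] [MeasurableSpace S] [BorelSpace S]

/-- A control plan: a sequence of Borel measurable selections of the multifunction `U`. -/
structure Plan (M : Model n Uc S) where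
  π : ℕ → (Fin n → ℝ) → Uc
  measurable : ∀ t, Measurable (π t)
  feasible : ∀ t, ∀ y ∈ M.Y, π t y ∈ M.U y

/-- The law of the state `y^{π,y₀}(t)` of the controlled stochastic recursion started at
`y₀` and driven by the i.i.d. noise with common law `ν`, defined by the Markov recursion.  -/
def stateLaw (M : Model n Uc S) (t : ℕ) :
    (ℕ → (Fin n → ℝ) → Uc) → (Fin n → ℝ) → Measure (Fin n → ℝ) :=
  Nat.rec (motive := fun _ => (ℕ → (Fin n → ℝ) → Uc) → (Fin n → ℝ) → Measure (Fin n → ℝ))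
    (fun _ y => Measure.dirac y)
    (fun _ ih π y =>
      (M.ν.map fun s => M.f y (π 0 y) s).bind fun y' => ih (fun j => π (j + 1)) y') t

/-- The joint law of the state-control pair `(y^{π,y₀}(t), u^{π,y₀}(t))`. -/
def saLaw (M : Model n Uc S) (t : ℕ) (π : ℕ → (Fin n → ℝ) → Uc) (y0 : Fin n → ℝ) :
    Measure ((Fin n → ℝ) × Uc) :=
  (stateLaw M t π y0).map fun z => (z, π t z)

/-- `E[q(y^{π,y₀}(t), u^{π,y₀}(t))]`. -/
def expSA (M : Model n Uc S) (t : ℕ) (π : ℕ → (Fin n → ℝ) → Uc) (y0 : Fin n → ℝ)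
    (q : (Fin n → ℝ) → Uc → ℝ) : ℝ :=
  ∫ p, q p.1 p.2 ∂saLaw M t π y0

/-- The finite horizon average expected cost `(1/T) E[Σ_{t=0}^{T-1} k(y(t),u(t))]`. -/
def costT (M : Model n Uc S) (k : (Fin n → ℝ) → Uc → ℝ) (T : ℕ) (π : ℕ → (Fin n → ℝ) → Uc)
    (y0 : Fin n → ℝ) : ℝ :=
  (1 / (T : ℝ)) * ∑ t ∈ Finset.range T, expSA M t π y0 k

/-- The optimal value `v_T(y₀)` of the finite horizon problem. -/
def vT (M : Model n Uc S) (k : (Fin n → ℝ) → Uc → ℝ) (T : ℕ) (y0 : Fin n → ℝ) : ℝ :=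
  ⨅ π : Plan M, costT M k T π.π y0

/-- The expected discounted cost `ε Σ_{t=0}^∞ (1-ε)^t E[k(y(t),u(t))]`. -/
def costDisc (M : Model n Uc S) (k : (Fin n → ℝ) → Uc → ℝ) (ε : ℝ)
    (π : ℕ → (Fin n → ℝ) → Uc) (y0 : Fin n → ℝ) : ℝ :=
  ε * ∑' t : ℕ, (1 - ε) ^ t * expSA M t π y0 k

/-- The optimal value `h_ε(y₀)` of the discounted problem. -/
def hEps (M : Model n Uc S) (k : (Fin n → ℝ) → Uc → ℝ) (ε : ℝ) (y0 : Fin n → ℝ) : ℝ :=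
  ⨅ π : Plan M, costDisc M k ε π.π y0

/-- The graph `G` of the multifunction `U`. -/
def graphG (M : Model n Uc S) : Set ((Fin n → ℝ) × Uc) := {p | p.1 ∈ M.Y ∧ p.2 ∈ M.U p.1}

/-- `E[φ(f(y,u,s))]`, the expectation over the noise of `φ` evaluated after one step. -/
def Ef (M : Model n Uc S) (φ : (Fin n → ℝ) → ℝ) (y : Fin n → ℝ) (u : Uc) : ℝ :=
  ∫ s, φ (M.f y u s) ∂M.ν

/-- A measure on `Y × Uc` is concentrated on the graph `G` (this encodes measures defined
on Borel subsets of `G`). -/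
def onG (M : Model n Uc S) (γ : Measure ((Fin n → ℝ) × Uc)) : Prop := γ (graphG M)ᶜ = 0

/-- The set `W` of stationary measures. -/
def Wset (M : Model n Uc S) : Set (Measure ((Fin n → ℝ) × Uc)) :=
  {γ | IsProbabilityMeasure γ ∧ onG M γ ∧
    ∀ φ : (Fin n → ℝ) → ℝ, Continuous φ → ∫ p, (Ef M φ p.1 p.2 - φ p.1) ∂γ = 0}

/-- The set `W(ε, y₀)` of discounted stationary measures. -/
def Weps (M : Model n Uc S) (ε : ℝ) (y0 : Fin n → ℝ) : Set (Measure ((Fin n → ℝ) × Uc)) :=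
  {γ | IsProbabilityMeasure γ ∧ onG M γ ∧
    ∀ φ : (Fin n → ℝ) → ℝ, Continuous φ →
      ∫ p, ((1 - ε) * (Ef M φ p.1 p.2 - φ p.1) + ε * (φ y0 - φ p.1)) ∂γ = 0}

/-- The optimal value `k*(ε, y₀)` of the IDLP problem over `W(ε, y₀)`. -/
def kStarEps (M : Model n Uc S) (k : (Fin n → ℝ) → Uc → ℝ) (ε : ℝ) (y0 : Fin n → ℝ) : ℝ :=
  sInf ((fun γ : Measure ((Fin n → ℝ) × Uc) => ∫ p, k p.1 p.2 ∂γ) '' Weps M ε y0)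

/-- The optimal value `k*` of the IDLP problem over `W`. -/
def kStar (M : Model n Uc S) (k : (Fin n → ℝ) → Uc → ℝ) : ℝ :=
  sInf ((fun γ : Measure ((Fin n → ℝ) × Uc) => ∫ p, k p.1 p.2 ∂γ) '' Wset M)

/-- The optimal value `μ*(ε, y₀)` of the problem dual to the IDLP problem over `W(ε,y₀)`. -/
def muStarEps (M : Model n Uc S) (k : (Fin n → ℝ) → Uc → ℝ) (ε : ℝ) (y0 : Fin n → ℝ) : ℝ :=
  sSup {r : ℝ | ∃ ψ : (Fin n → ℝ) → ℝ, Continuous ψ ∧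
    r = sInf ((fun p : (Fin n → ℝ) × Uc =>
      k p.1 p.2 + (1 - ε) * (Ef M ψ p.1 p.2 - ψ p.1) + ε * (ψ y0 - ψ p.1)) '' graphG M)}

/-- The optimal value `μ*` of the problem dual to the IDLP problem over `W`. -/
def muStar (M : Model n Uc S) (k : (Fin n → ℝ) → Uc → ℝ) : ℝ :=
  sSup {r : ℝ | ∃ ψ : (Fin n → ℝ) → ℝ, Continuous ψ ∧
    r = sInf ((fun p : (Fin n → ℝ) × Uc => k p.1 p.2 + Ef M ψ p.1 p.2 - ψ p.1) '' graphG M)}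

/-- The feasible set `Ω(y₀)` of the augmented IDLP problem. -/
def OmegaSet (M : Model n Uc S) (y0 : Fin n → ℝ) :
    Set (Measure ((Fin n → ℝ) × Uc) × Measure ((Fin n → ℝ) × Uc)) :=
  {p | p.1 ∈ Wset M ∧ IsFiniteMeasure p.2 ∧ onG M p.2 ∧
    ∀ φ : (Fin n → ℝ) → ℝ, Continuous φ →
      ∫ q, (φ y0 - φ q.1) ∂p.1 + ∫ q, (Ef M φ q.1 q.2 - φ q.1) ∂p.2 = 0}

/-- The optimal value `k*(y₀)` of the augmented IDLP problem. -/
def kStarAug (M : Model n Uc S) (k : (Fin n → ℝ) → Uc → ℝ) (y0 : Fin n → ℝ) : ℝ :=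
  sInf ((fun p : Measure ((Fin n → ℝ) × Uc) × Measure ((Fin n → ℝ) × Uc) =>
    ∫ q, k q.1 q.2 ∂p.1) '' OmegaSet M y0)

/-- Feasibility of `(μ, ψ, η)` for the problem dual to the augmented IDLP problem. -/
def DualFeas (M : Model n Uc S) (k : (Fin n → ℝ) → Uc → ℝ) (y0 : Fin n → ℝ)
    (ψ η : (Fin n → ℝ) → ℝ) (μ : ℝ) : Prop :=
  (∀ p ∈ graphG M, 0 ≤ k p.1 p.2 + (ψ y0 - ψ p.1) + Ef M η p.1 p.2 - η p.1 - μ) ∧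
  (∀ p ∈ graphG M, 0 ≤ Ef M ψ p.1 p.2 - ψ p.1)

/-- The optimal value `d*(y₀)` of the dual (with continuous test functions) of the
augmented IDLP problem. -/
def dStar (M : Model n Uc S) (k : (Fin n → ℝ) → Uc → ℝ) (y0 : Fin n → ℝ) : ℝ :=
  sSup {μ : ℝ | ∃ ψ η : (Fin n → ℝ) → ℝ, Continuous ψ ∧ Continuous η ∧
    DualFeas M k y0 ψ η μ}

/-- Bounded Borel measurable real valued functions. -/
def BddBorel (ψ : (Fin n → ℝ) → ℝ) : Prop := Measurable ψ ∧ ∃ C : ℝ, ∀ y, |ψ y| ≤ C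

/-- The optimal value `d̂*(y₀)` of the relaxed dual (with bounded Borel test functions) of
the augmented IDLP problem. -/
def dHatStar (M : Model n Uc S) (k : (Fin n → ℝ) → Uc → ℝ) (y0 : Fin n → ℝ) : ℝ :=
  sSup {μ : ℝ | ∃ ψ η : (Fin n → ℝ) → ℝ, BddBorel ψ ∧ BddBorel η ∧ DualFeas M k y0 ψ η μ}

/-- The occupational measure `γ^{π,y₀,T}`. -/
def occT (M : Model n Uc S) (T : ℕ) (π : ℕ → (Fin n → ℝ) → Uc) (y0 : Fin n → ℝ) :
    Measure ((Fin n → ℝ) × Uc) :=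
  (T : ℝ≥0∞)⁻¹ • ∑ t ∈ Finset.range T, saLaw M t π y0

/-- The discounted occupational measure `γ_d^{π,y₀,ε}`. -/
def discOcc (M : Model n Uc S) (ε : ℝ) (π : ℕ → (Fin n → ℝ) → Uc) (y0 : Fin n → ℝ) :
    Measure ((Fin n → ℝ) × Uc) :=
  ENNReal.ofReal ε • Measure.sum fun t : ℕ => ENNReal.ofReal (1 - ε) ^ t • saLaw M t π y0

/-- The set `Θ_ε(y₀)` of discounted occupational measures, as a set of probability
measures (carrying the topology of weak convergence). -/
def ThetaEps (M : Model n Uc S) (ε : ℝ) (y0 : Fin n → ℝ) :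
    Set (ProbabilityMeasure ((Fin n → ℝ) × Uc)) :=
  {μ | ∃ π : Plan M, μ.toMeasure = discOcc M ε π.π y0}

/-- `Θ_ε := ∪_{y₀ ∈ Y} Θ_ε(y₀)`. -/
def ThetaEpsAll (M : Model n Uc S) (ε : ℝ) : Set (ProbabilityMeasure ((Fin n → ℝ) × Uc)) :=
  ⋃ y0 ∈ M.Y, ThetaEps M ε y0

/-- The set `Γ_T(y₀)` of occupational measures. -/
def GammaT (M : Model n Uc S) (T : ℕ) (y0 : Fin n → ℝ) :
    Set (ProbabilityMeasure ((Fin n → ℝ) × Uc)) :=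
  {μ | ∃ π : Plan M, μ.toMeasure = occT M T π.π y0}

/-- `Γ_T := ∪_{y₀ ∈ Y} Γ_T(y₀)`. -/
def GammaTAll (M : Model n Uc S) (T : ℕ) : Set (ProbabilityMeasure ((Fin n → ℝ) × Uc)) :=
  ⋃ y0 ∈ M.Y, GammaT M T y0

/-- `W` as a set of probability measures. -/
def WsetPM (M : Model n Uc S) : Set (ProbabilityMeasure ((Fin n → ℝ) × Uc)) :=
  {μ | μ.toMeasure ∈ Wset M}

/-- `W(ε,y₀)` as a set of probability measures. -/
def WepsPM (M : Model n Uc S) (ε : ℝ) (y0 : Fin n → ℝ) :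
    Set (ProbabilityMeasure ((Fin n → ℝ) × Uc)) :=
  {μ | μ.toMeasure ∈ Weps M ε y0}

/-- The set of finite convex combinations of elements of a set of probability measures,
i.e. its convex hull. -/
def convexCombos {α : Type*} [MeasurableSpace α] (A : Set (ProbabilityMeasure α)) :
    Set (ProbabilityMeasure α) :=
  {μ | ∃ (m : ℕ) (w : Fin m → ℝ≥0) (γ : Fin m → ProbabilityMeasure α),
    (∀ i, γ i ∈ A) ∧ (∑ i, w i) = 1 ∧
    μ.toMeasure = ∑ i, (w i : ℝ≥0∞) • (γ i).toMeasure}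

/-- Membership in the set `D₁(y₀)`. -/
def D1mem (M : Model n Uc S) (y0 : Fin n → ℝ) (γ : Measure ((Fin n → ℝ) × Uc)) : Prop :=
  ∃ ξ : ℕ → Measure ((Fin n → ℝ) × Uc),
    (∀ l, IsFiniteMeasure (ξ l) ∧ onG M (ξ l)) ∧
    ∀ φ : (Fin n → ℝ) → ℝ, Continuous φ →
      Tendsto (fun l => ∫ q, (Ef M φ q.1 q.2 - φ q.1) ∂ξ l) atTop
        (𝓝 (∫ q, (φ q.1 - φ y0) ∂γ))

/-- A control plan is periodic regime generating (PRG) for the initial point `y₀`. -/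
def IsPRG (M : Model n Uc S) (π : Plan M) (y0 : Fin n → ℝ) : Prop :=
  ∃ T0 Tp : ℕ, 0 < Tp ∧
    ∀ q : ((Fin n → ℝ) × Uc) → ℝ, Continuous q →
      ∀ t, T0 ≤ t → ∫ p, q p ∂saLaw M t π.π y0 = ∫ p, q p ∂saLaw M (t + Tp) π.π y0

/-- The optimal value `V_per(y₀)` over periodic regime generating control plans. -/
def Vper (M : Model n Uc S) (k : (Fin n → ℝ) → Uc → ℝ) (y0 : Fin n → ℝ) : ℝ :=
  sInf {c : ℝ | ∃ π : Plan M, IsPRG M π y0 ∧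
    Tendsto (fun T => costT M k T π.π y0) atTop (𝓝 c)}

/-- The optimal value `k*_θ(y₀)` of the perturbed augmented IDLP problem. -/
def kStarTheta (M : Model n Uc S) (k θ : (Fin n → ℝ) → Uc → ℝ) (y0 : Fin n → ℝ) : ℝ :=
  sInf ((fun p : Measure ((Fin n → ℝ) × Uc) × Measure ((Fin n → ℝ) × Uc) =>
    ∫ q, k q.1 q.2 ∂p.1 + ∫ q, θ q.1 q.2 ∂p.2) '' OmegaSet M y0)

/-- Feasibility of `(μ, ψ, η)` for the perturbed dual problem. -/
def DualFeasTheta (M : Model n Uc S) (k θ : (Fin n → ℝ) → Uc → ℝ) (y0 : Fin n → ℝ)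
    (ψ η : (Fin n → ℝ) → ℝ) (μ : ℝ) : Prop :=
  (∀ p ∈ graphG M, 0 ≤ k p.1 p.2 + (ψ y0 - ψ p.1) + Ef M η p.1 p.2 - η p.1 - μ) ∧
  (∀ p ∈ graphG M, -θ p.1 p.2 ≤ Ef M ψ p.1 p.2 - ψ p.1)

/-- The optimal value `d*_θ(y₀)` of the perturbed dual problem. -/
def dStarTheta (M : Model n Uc S) (k θ : (Fin n → ℝ) → Uc → ℝ) (y0 : Fin n → ℝ) : ℝ :=
  sSup {μ : ℝ | ∃ ψ η : (Fin n → ℝ) → ℝ, Continuous ψ ∧ Continuous η ∧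
    DualFeasTheta M k θ y0 ψ η μ}

/-- The optimal value `d̄*_θ(y₀)` of the second form of the perturbed dual problem. -/
def dBarTheta (M : Model n Uc S) (k θ : (Fin n → ℝ) → Uc → ℝ) (y0 : Fin n → ℝ) : ℝ :=
  sSup {r : ℝ | ∃ ψ η : (Fin n → ℝ) → ℝ, Continuous ψ ∧ Continuous η ∧ r = ψ y0 ∧
    (∀ p ∈ graphG M, 0 ≤ k p.1 p.2 - ψ p.1 + Ef M η p.1 p.2 - η p.1) ∧
    (∀ p ∈ graphG M, -θ p.1 p.2 ≤ Ef M ψ p.1 p.2 - ψ p.1)}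

/-- If all partial sums of `f` are nonnegative, then so is every discounted sum of `f`. -/
theorem hasSum_pow_mul_nonneg_of_sum_range_nonneg {r : ℝ} (hr0 : 0 ≤ r) (hr1 : r ≤ 1)
    {f : ℕ → ℝ} (hf : ∀ T, 0 ≤ ∑ t ∈ Finset.range T, f t) {s : ℝ}
    (hs : HasSum (fun t => r ^ t * f t) s) : 0 ≤ s := by
  have key : ∀ K : ℕ, r ^ K * ∑ t ∈ Finset.range K, f t ≤
      ∑ t ∈ Finset.range K, r ^ t * f t := by
    intro K
    induction K with
    | zero => simp
    | succ K ih =>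
      have h1 : r ^ (K + 1) * ∑ t ∈ Finset.range (K + 1), f t ≤
          r ^ K * ∑ t ∈ Finset.range (K + 1), f t :=
        mul_le_mul_of_nonneg_right (pow_le_pow_of_le_one hr0 hr1 K.le_succ) (hf _)
      rw [Finset.sum_range_succ f K] at h1 ⊢
      rw [Finset.sum_range_succ]
      linarith
  exact ge_of_tendsto' hs.tendsto_sum_nat
    fun K => (mul_nonneg (pow_nonneg hr0 K) (hf K)).trans (key K)

/-- If `g` is bounded by `M₀` and its partial sums of length exceeding `m` dominate those of the
constant `σ + δ`, where `σ` is the discounted average of `g`, then `m` cannot be small. -/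
theorem le_mul_one_sub_pow_of_le_sum_range {M₀ : ℝ} {g : ℕ → ℝ} (hg : ∀ t, |g t| ≤ M₀)
    {ε : ℝ} (hε0 : 0 < ε) (hε1 : ε < 1) {σ : ℝ}
    (hσ : σ = ε * ∑' t : ℕ, (1 - ε) ^ t * g t) {δ : ℝ} (hδ : 0 ≤ δ) {m : ℕ}
    (h : ∀ T, m < T → T * (σ + δ) ≤ ∑ t ∈ Finset.range T, g t) :
    δ ≤ (M₀ + |σ| + δ) * (1 - (1 - ε) ^ m) := by
  have hr0 : 0 ≤ 1 - ε := by linarith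
  have hr1 : 1 - ε < 1 := by linarith
  have hgeom : HasSum (fun t : ℕ => (1 - ε) ^ t) ε⁻¹ := by
    simpa using hasSum_geometric_of_lt_one hr0 hr1
  have hsum : Summable fun t : ℕ => (1 - ε) ^ t * g t := by
    refine Summable.of_norm_bounded (hgeom.summable.mul_right M₀) fun t => ?_
    rw [norm_mul, norm_pow, Real.norm_of_nonneg hr0]
    exact mul_le_mul_of_nonneg_left (hg t) (pow_nonneg hr0 t)
  have hhead : HasSum (fun t : ℕ => (1 - ε) ^ t * if t < m then M₀ + |σ| + δ else 0)
      ((M₀ + |σ| + δ) * ((1 - (1 - ε) ^ m) / ε)) := by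
    have h1 : ∑ t ∈ Finset.range m, ((1 - ε) ^ t * if t < m then M₀ + |σ| + δ else 0) =
        (M₀ + |σ| + δ) * ((1 - (1 - ε) ^ m) / ε) := by
      have h2 : ∑ t ∈ Finset.range m, (1 - ε) ^ t = (1 - (1 - ε) ^ m) / ε := by
        rw [geom_sum_eq hr1.ne, ← neg_div_neg_eq]
        congr 1 <;> ring
      rw [← h2, Finset.mul_sum]
      refine Finset.sum_congr rfl fun t ht => ?_
      rw [if_pos (Finset.mem_range.1 ht), mul_comm]
    rw [← h1]
    refine hasSum_sum_of_ne_finset_zero fun t ht => ?_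
    rw [if_neg (by simpa using ht), mul_zero]
  have htot := (hsum.hasSum.sub (hgeom.mul_right (σ + δ))).add hhead
  have hnonneg : 0 ≤ (∑' t : ℕ, (1 - ε) ^ t * g t) - ε⁻¹ * (σ + δ) +
      (M₀ + |σ| + δ) * ((1 - (1 - ε) ^ m) / ε) := by
    refine hasSum_pow_mul_nonneg_of_sum_range_nonneg hr0 hr1.le
      (f := fun t => g t - (σ + δ) + if t < m then M₀ + |σ| + δ else 0) (fun T => ?_)
      (by simpa only [mul_add, mul_sub] using htot)
    have hM₀ : 0 ≤ M₀ := (abs_nonneg _).trans (hg 0)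
    rcases le_or_gt T m with hT | hT
    · refine Finset.sum_nonneg fun t ht => ?_
      rw [if_pos ((Finset.mem_range.1 ht).trans_le hT)]
      linarith [neg_abs_le (g t), hg t, le_abs_self σ]
    · have h1 : ∑ t ∈ Finset.range T, (if t < m then M₀ + |σ| + δ else 0) =
          m * (M₀ + |σ| + δ) := by
        rw [← Finset.sum_filter, Finset.sum_const, nsmul_eq_mul]
        have h2 : Finset.filter (fun t => t < m) (Finset.range T) = Finset.range m := by
          ext t
          simp only [Finset.mem_filter, Finset.mem_range]
          omega
        rw [h2, Finset.card_range]
      rw [Finset.sum_add_distrib, Finset.sum_sub_distrib, h1, Finset.sum_const,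
        Finset.card_range, nsmul_eq_mul]
      have h3 : 0 ≤ (m : ℝ) * (M₀ + |σ| + δ) := by positivity
      linarith [h T hT]
  have hε : (∑' t : ℕ, (1 - ε) ^ t * g t) - ε⁻¹ * (σ + δ) +
      (M₀ + |σ| + δ) * ((1 - (1 - ε) ^ m) / ε) =
      ((M₀ + |σ| + δ) * (1 - (1 - ε) ^ m) - δ) / ε := by
    have h4 : ∑' t : ℕ, (1 - ε) ^ t * g t = σ / ε := by
      rw [hσ, mul_div_cancel_left₀ _ hε0.ne']
    rw [h4]
    field_simp
    ring
  rw [hε, le_div_iff₀ hε0, zero_mul] at hnonneg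
  linarith

/-- for a function `g : ℕ → ℝ` with `|g| ≤ M₀`, `ε ∈ (0,1)` and
`σ = ε Σ (1-ε)^t g(t)`, for every `δ > 0` there is a positive integer `T` with
`T ≥ δ / ((4M₀ + 4|σ| + δ)(−ln(1−ε)))` such that `(1/T) Σ_{t<T} g(t) < σ + δ + 2M₀/T`. -/
theorem statement17 (M₀ : ℝ) (hM₀ : 0 < M₀) (g : ℕ → ℝ) (hg : ∀ t, |g t| ≤ M₀)
    (ε : ℝ) (hε : ε ∈ Set.Ioo (0 : ℝ) 1)
    (σ : ℝ) (hσ : σ = ε * ∑' t : ℕ, (1 - ε) ^ t * g t) (δ : ℝ) (hδ : 0 < δ) :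
    ∃ T : ℕ, 0 < T ∧
      δ / ((4 * M₀ + 4 * |σ| + δ) * (-Real.log (1 - ε))) ≤ (T : ℝ) ∧
      (1 / (T : ℝ)) * ∑ t ∈ Finset.range T, g t < σ + δ + 2 * M₀ / (T : ℝ) := by
  obtain ⟨hε0, hε1⟩ := hε
  by_contra! hcon
  set C := 4 * M₀ + 4 * |σ| + δ with hC
  have hσ0 := abs_nonneg σ
  have hCpos : 0 < C := by positivity
  have hL : 0 < -Real.log (1 - ε) := by
    linarith [Real.log_neg (by linarith : 0 < 1 - ε) (by linarith)]
  set B := δ / (C * (-Real.log (1 - ε))) with hB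
  have hBpos : 0 < B := by positivity
  obtain ⟨m, hm⟩ : ∃ m, ⌈B⌉₊ = m + 1 :=
    Nat.exists_eq_succ_of_ne_zero (Nat.ceil_pos.2 hBpos).ne'
  have hmB : (m : ℝ) < B := Nat.lt_ceil.1 (by omega)
  have hpow : 1 - (1 - ε) ^ m < δ / C := by
    have h1 : (1 - ε) ^ m = Real.exp (m * Real.log (1 - ε)) := by
      rw [Real.exp_nat_mul, Real.exp_log (by linarith)]
    have h2 : m * (-Real.log (1 - ε)) < δ / C := by
      have h3 := mul_lt_mul_of_pos_right hmB hL
      have h4 : B * (-Real.log (1 - ε)) = δ / C := by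
        rw [hB, ← div_div, div_mul_cancel₀ _ hL.ne']
      linarith
    have h5 := Real.add_one_le_exp (m * Real.log (1 - ε))
    linarith
  have hle : δ ≤ (M₀ + |σ| + δ) * (1 - (1 - ε) ^ m) := by
    refine le_mul_one_sub_pow_of_le_sum_range hg hε0 hε1 hσ hδ.le fun T hT => ?_
    have hT0 : 0 < T := by omega
    have hT' : (0 : ℝ) < T := by exact_mod_cast hT0
    have h1 := hcon T hT0 (Nat.ceil_le.1 (by omega))
    rw [one_div_mul_eq_div, le_div_iff₀ hT', add_mul, div_mul_cancel₀ _ hT'.ne'] at h1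
    linarith
  have hlt : (M₀ + |σ| + δ) * (1 - (1 - ε) ^ m) < C * (δ / C) :=
    (mul_lt_mul_of_pos_left hpow (by positivity)).trans_le
      (mul_le_mul_of_nonneg_right (by linarith) (by positivity))
  rw [mul_div_cancel₀ _ hCpos.ne'] at hlt
  linarith

end StochLP
end
end

section
/- Let g : ℕ → ℝ satisfy |g(t)| ≤ M for all t, let T be a positive integer, and set σ := (1/T) Σ_{t=0}^{T−1} g(t). Then for every δ > 0 there exists T* ∈ {0, 1, …, T−1} such that (1/S) Σ_{t=0}^{S−1} g(T* + t) ≤ σ + δ for all S ∈ {1, …, T−T*}. Moreover, T* can be chosen so that T − T* ≥ l(T), where l(T) depends only on M and δ and l(T) → ∞ as T → ∞. -/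
open MeasureTheory Filter Set Topology
open scoped ENNReal NNReal

noncomputable section

namespace StochLP

variable {n : ℕ} {Uc S : Type} [MetricSpace Uc] [CompactSpace Uc] [MeasurableSpace Uc]
  [BorelSpace Uc] [TopologicalSpace S] [PolishSpace S] [MeasurableSpace S] [BorelSpace S]

/-- for a function `g : ℕ → ℝ` with `|g| ≤ M₀`, a positive integer `T` and
`σ = (1/T) Σ_{t<T} g(t)`, for every `δ > 0` there is `T* ∈ {0,…,T−1}` such that all the
forward averages from `T*` of length `S ≤ T − T*` are at most `σ + δ`; moreover `T*` can be
chosen with `T − T* ≥ l(T)`, where `l` depends only on `M₀` and `δ` and `l(T) → ∞`. -/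
theorem statement18 (M₀ δ : ℝ) (hM₀ : 0 < M₀) (hδ : 0 < δ) :
    ∃ l : ℕ → ℕ, Tendsto l atTop atTop ∧
      ∀ T : ℕ, 0 < T → ∀ g : ℕ → ℝ, (∀ t, |g t| ≤ M₀) →
        ∃ Tstar : ℕ, Tstar < T ∧ l T ≤ T - Tstar ∧
          ∀ Sl : ℕ, 1 ≤ Sl → Sl ≤ T - Tstar →
            (1 / (Sl : ℝ)) * ∑ t ∈ Finset.range Sl, g (Tstar + t) ≤
              (1 / (T : ℝ)) * ∑ t ∈ Finset.range T, g t + δ := by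
  refine ⟨fun T => ⌈δ / (2 * M₀ + δ) * T⌉₊, ?_, fun T hT g hg => ?_⟩
  · have hc : 0 < δ / (2 * M₀ + δ) := by positivity
    exact tendsto_nat_ceil_atTop.comp (tendsto_natCast_atTop_atTop.const_mul_atTop hc)
  have hT' : (0 : ℝ) < T := Nat.cast_pos.mpr hT
  set σ : ℝ := (1 / (T : ℝ)) * ∑ t ∈ Finset.range T, g t with hσ
  have hσT : ∑ t ∈ Finset.range T, g t = T * σ := by rw [hσ]; field_simp
  have hσM : σ ≤ M₀ := by
    have h := Finset.sum_le_card_nsmul (Finset.range T) g M₀ fun t _ => (abs_le.mp (hg t)).2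
    rw [hσT, Finset.card_range, nsmul_eq_mul] at h
    exact le_of_mul_le_mul_left h hT'
  -- `p s` is the excess of the partial sum of `g` over the line of slope `σ + δ`
  set p : ℕ → ℝ := fun s => ∑ t ∈ Finset.range s, g t - s * (σ + δ) with hp
  have hp0 : p 0 = 0 := by simp [hp]
  have hpT : p T = -(δ * T) := by simp only [hp, hσT]; ring
  obtain ⟨m, hm, hmax⟩ := Finset.exists_max_image (Finset.range (T + 1)) p ⟨0, by simp⟩
  have hm0 : 0 ≤ p m := hp0 ▸ hmax 0 (by simp)
  have hmT : m < T := by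
    refine lt_of_le_of_ne (Nat.lt_succ_iff.mp (Finset.mem_range.mp hm)) ?_
    rintro rfl
    rw [hpT] at hm0
    linarith [mul_pos hδ hT']
  have hadd (S : ℕ) :
      p (m + S) = p m + ∑ t ∈ Finset.range S, g (m + t) - S * (σ + δ) := by
    simp only [hp, Finset.sum_range_add, Nat.cast_add]
    ring
  refine ⟨m, hmT, ?_, fun S hS1 hS => ?_⟩
  · rw [Nat.ceil_le, div_mul_eq_mul_div, div_le_iff₀ (by positivity)]
    have h := hadd (T - m)
    rw [Nat.add_sub_cancel' hmT.le, hpT] at h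
    have hlow := Finset.card_nsmul_le_sum (Finset.range (T - m)) (fun t => g (m + t)) (-M₀)
      fun t _ => (abs_le.mp (hg (m + t))).1
    rw [Finset.card_range, nsmul_eq_mul] at hlow
    have hupp : ((T - m : ℕ) : ℝ) * σ ≤ (T - m : ℕ) * M₀ :=
      mul_le_mul_of_nonneg_left hσM (Nat.cast_nonneg _)
    linarith
  · have hS' : (0 : ℝ) < S := Nat.cast_pos.mpr hS1
    have h := hmax (m + S) (Finset.mem_range.mpr (by omega))
    rw [hadd S] at h
    rw [one_div_mul_eq_div, div_le_iff₀ hS']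
    linarith

end StochLP
end
end
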